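/- The relativisation map is positive, unital and *-preserving for POVM references: Let G be a finite group, g ↦ U_S(g) a unitary representation of G on H_S, and (Q_g)_{g∈G} a family of positive semidefinite operators on H_R with Σ_{g∈G} Q_g = 1. Then the relativisation map ¥ satisfies: ¥(1) = 1; ¥(A^*) = ¥(A)^* for every operator A on H_S; and whenever A is positive semidefinite on H_S, ¥(A) is positive semidefinite on H_S⊗H_R. -/

import Mathlib

open scoped InnerProductSpace
open ContinuousLinearMap

noncomputable section

/-- An abstract tensor product structure realising the Hilbert space `H` as the tensor
product of the Hilbert spaces `E` and `F`, with the induced inner product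
`⟪x⊗y, x'⊗y'⟫ = ⟪x,x'⟫⟪y,y'⟫`, and with the induced action `tmap B C = B ⊗ C` of pairs
of operators. -/
structure TensorStruct (E F H : Type*)
    [NormedAddCommGroup E] [InnerProductSpace ℂ E]
    [NormedAddCommGroup F] [InnerProductSpace ℂ F]
    [NormedAddCommGroup H] [InnerProductSpace ℂ H] where
  tmul : E →ₗ[ℂ] F →ₗ[ℂ] H
  inner_tmul : ∀ (x x' : E) (y y' : F),
    ⟪tmul x y, tmul x' y'⟫_ℂ = ⟪x, x'⟫_ℂ * ⟪y, y'⟫_ℂ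
  span_tmul : Submodule.span ℂ {z : H | ∃ x y, z = tmul x y} = ⊤
  tmap : (E →L[ℂ] E) → (F →L[ℂ] F) → (H →L[ℂ] H)
  tmap_tmul : ∀ (B : E →L[ℂ] E) (C : F →L[ℂ] F) (x : E) (y : F),
    tmap B C (tmul x y) = tmul (B x) (C y)

/-- The relativisation map `¥`, sending an operator `A` on `H_S` to the operator
`¥(A) = ∑ g, (U_S(g) A U_S(g)^*) ⊗ Q_g` on `H_S⊗H_R`. -/
def yen {HS HR H : Type*}
    [NormedAddCommGroup HS] [InnerProductSpace ℂ HS] [FiniteDimensional ℂ HS]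
    [NormedAddCommGroup HR] [InnerProductSpace ℂ HR] [FiniteDimensional ℂ HR]
    [NormedAddCommGroup H] [InnerProductSpace ℂ H] [FiniteDimensional ℂ H]
    (T : TensorStruct HS HR H)
    {G : Type*} [Group G] [Fintype G]
    (US : G → (HS →L[ℂ] HS)) (Q : G → (HR →L[ℂ] HR))
    (A : HS →L[ℂ] HS) : H →L[ℂ] H :=
  ∑ g : G, T.tmap (US g * A * adjoint (US g)) (Q g)

open scoped ComplexOrder

namespace TensorStruct

variable {E F H : Type*}
  [NormedAddCommGroup E] [InnerProductSpace ℂ E]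
  [NormedAddCommGroup F] [InnerProductSpace ℂ F]
  [NormedAddCommGroup H] [InnerProductSpace ℂ H]

theorem clm_ext (T : TensorStruct E F H) {A B : H →L[ℂ] H}
    (h : ∀ x y, A (T.tmul x y) = B (T.tmul x y)) : A = B := by
  apply ContinuousLinearMap.coe_injective
  apply LinearMap.ext_on T.span_tmul
  rintro _ ⟨x, y, rfl⟩
  exact h x y

theorem tmap_mul (T : TensorStruct E F H) (B B' : E →L[ℂ] E) (C C' : F →L[ℂ] F) :
    T.tmap (B * B') (C * C') = T.tmap B C * T.tmap B' C' :=
  T.clm_ext fun x y => by simp [T.tmap_tmul]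

theorem sum_tmap_one {ι : Type*} [Fintype ι] (T : TensorStruct E F H)
    (Q : ι → (F →L[ℂ] F)) (hQ : ∑ i, Q i = 1) : ∑ i, T.tmap 1 (Q i) = 1 :=
  T.clm_ext fun x y => by
    simp only [sum_apply, T.tmap_tmul, ← map_sum]
    rw [← sum_apply, hQ]
    rfl

variable [FiniteDimensional ℂ E] [FiniteDimensional ℂ F] [FiniteDimensional ℂ H]

theorem adjoint_tmap (T : TensorStruct E F H) (B : E →L[ℂ] E) (C : F →L[ℂ] F) :
    adjoint (T.tmap B C) = T.tmap (adjoint B) (adjoint C) := by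
  refine T.clm_ext fun x y => ext_inner_left ℂ fun z => ?_
  rw [adjoint_inner_right]
  have hz : z ∈ Submodule.span ℂ {z : H | ∃ x y, z = T.tmul x y} := by
    simp [T.span_tmul]
  induction hz using Submodule.span_induction with
  | mem z hz =>
    obtain ⟨x', y', rfl⟩ := hz
    simp only [T.tmap_tmul, T.inner_tmul, adjoint_inner_right]
  | zero => simp
  | add u v _ _ hu hv => simp only [map_add, inner_add_left, hu, hv]
  | smul c u _ hu => simp only [map_smul, inner_smul_left, hu]

theorem isPositive_tmap (T : TensorStruct E F H) {B : E →L[ℂ] E} {C : F →L[ℂ] F}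
    (hB : B.IsPositive) (hC : C.IsPositive) : (T.tmap B C).IsPositive := by
  rw [← nonneg_iff_isPositive] at hB hC ⊢
  obtain ⟨S, rfl⟩ := CStarAlgebra.nonneg_iff_eq_star_mul_self.mp hB
  obtain ⟨R, rfl⟩ := CStarAlgebra.nonneg_iff_eq_star_mul_self.mp hC
  rw [T.tmap_mul, star_eq_adjoint, star_eq_adjoint, ← T.adjoint_tmap, ← star_eq_adjoint]
  exact star_mul_self_nonneg _

end TensorStruct

theorem isPositive_of_forall_inner_nonneg {E : Type*}
    [NormedAddCommGroup E] [InnerProductSpace ℂ E] [FiniteDimensional ℂ E]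
    {A : E →L[ℂ] E} (hA : ∀ x, 0 ≤ ⟪x, A x⟫_ℂ) : A.IsPositive := by
  rw [isPositive_iff_complex]
  intro x
  have h : 0 ≤ ⟪A x, x⟫_ℂ := by
    rw [← inner_conj_symm]
    exact star_nonneg_iff.mpr (hA x)
  obtain ⟨h₁, h₂⟩ := Complex.le_def.mp h
  exact ⟨Complex.ext rfl h₂, h₁⟩

/-- **The relativisation map is positive, unital and *-preserving for POVM
references.** For a unitary representation `U_S` of a finite group `G` and a family
`(Q_g)` of positive semidefinite operators on `H_R` summing to `1`:
`¥(1) = 1`, `¥(A^*) = ¥(A)^*`, and `¥(A)` is positive semidefinite whenever `A` is. -/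
theorem yen_positive_unital_star
    {HS HR H : Type*}
    [NormedAddCommGroup HS] [InnerProductSpace ℂ HS] [FiniteDimensional ℂ HS]
    [NormedAddCommGroup HR] [InnerProductSpace ℂ HR] [FiniteDimensional ℂ HR]
    [NormedAddCommGroup H] [InnerProductSpace ℂ H] [FiniteDimensional ℂ H]
    (T : TensorStruct HS HR H)
    {G : Type*} [Group G] [Fintype G]
    -- `U_S` is a unitary representation of `G` on `H_S`
    (US : G → (HS →L[ℂ] HS))
    (hUS1 : US 1 = 1)
    (hUSmul : ∀ g h : G, US (g * h) = US g * US h)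
    (hUSuni : ∀ g : G, adjoint (US g) * US g = 1 ∧ US g * adjoint (US g) = 1)
    -- `(Q_g)` is a family of positive semidefinite operators summing to `1`
    (Q : G → (HR →L[ℂ] HR))
    (hQpos : ∀ (g : G) (x : HR), 0 ≤ ⟪x, Q g x⟫_ℂ)
    (hQsum : ∑ g : G, Q g = 1) :
    yen T US Q 1 = 1
    ∧ (∀ A : HS →L[ℂ] HS, yen T US Q (adjoint A) = adjoint (yen T US Q A))
    ∧ (∀ A : HS →L[ℂ] HS, (∀ x : HS, 0 ≤ ⟪x, A x⟫_ℂ) →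
        ∀ z : H, 0 ≤ ⟪z, yen T US Q A z⟫_ℂ) := by
  have hQ (g : G) : (Q g).IsPositive := isPositive_of_forall_inner_nonneg (hQpos g)
  refine ⟨?_, fun A => ?_, fun A hA => ?_⟩
  · simpa only [yen, mul_one, (hUSuni _).2] using T.sum_tmap_one Q hQsum
  · simp only [yen, map_sum]
    refine Finset.sum_congr rfl fun g _ => ?_
    rw [T.adjoint_tmap, (hQ g).isSelfAdjoint.adjoint_eq]
    simp only [← star_eq_adjoint, star_mul, star_star, mul_assoc]
  · have hA' := isPositive_of_forall_inner_nonneg hA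
    have hpos : (yen T US Q A).IsPositive := by
      rw [← nonneg_iff_isPositive]
      refine Finset.sum_nonneg fun g _ => ?_
      rw [nonneg_iff_isPositive]
      exact T.isPositive_tmap (hA'.conj_adjoint (US g)) (hQ g)
    exact hpos.inner_nonneg_right

end
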